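/- arXiv:2407.16416 — 2 statements merged into one kernel-verified Lean document; each statement's English description precedes it below -/
import Mathlib

section
/- Let X ⊂ ℝ^d be a relatively separated set and s > d. Then there exists a constant C > 0 such that for all B(H)-valued matrices A = [A_{k,l}]_{k,l∈X} and B = [B_{k,l}]_{k,l∈X} with finite Jaffard norms, the matrix product entries [A·B]_{k,l} = Σ_{n∈X} A_{k,n} B_{n,l} converge absolutely in B(H) for all k,l ∈ X, and the product matrix satisfies ‖A·B‖_{J_s} ≤ C ‖A‖_{J_s} ‖B‖_{J_s}, where ‖A‖_{J_s} = sup_{k,l∈X} ‖A_{k,l}‖ (1+|k−l|)^s. -/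
open scoped ENNReal
open Set

noncomputable section

/-- `ℝ^d` with the Euclidean norm. -/
abbrev Euc (d : ℕ) := EuclideanSpace ℝ (Fin d)

/-- A set `X ⊂ ℝ^d` is relatively separated if
`sup_{x ∈ ℝ^d} #(X ∩ (x + [0,1]^d)) < ∞`. -/
def RelSep {d : ℕ} (X : Set (Euc d)) : Prop :=
  ∃ N : ℕ, ∀ x : Euc d,
    (X ∩ {y | ∀ j, x j ≤ y j ∧ y j ≤ x j + 1}).Finite ∧
    (X ∩ {y | ∀ j, x j ≤ y j ∧ y j ≤ x j + 1}).ncard ≤ N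

/-- The Jaffard norm `sup_{k,l ∈ X} ‖A_{k,l}‖ (1+|k-l|)^s`. -/
noncomputable def jaffardNorm {d : ℕ} {X : Set (Euc d)} {H : Type*}
    [NormedAddCommGroup H] [InnerProductSpace ℂ H]
    (s : ℝ) (A : ↥X → ↥X → (H →L[ℂ] H)) : ℝ :=
  ⨆ q : ↥X × ↥X, ‖A q.1 q.2‖ * (1 + ‖(q.1 : Euc d) - (q.2 : Euc d)‖) ^ s

open MeasureTheory in
/-- Polynomial decay of order `s > d` is summable over a relatively separated set, uniformly in
the centre: compare the sum with the integral of `(1 + ‖x - y‖) ^ (-s)` over balls of radius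
`1 / 2` around the points of the set. -/
theorem RelSep.exists_tsum_one_add_norm_rpow_le {d : ℕ} {X : Set (Euc d)} (hX : RelSep X)
    {s : ℝ} (hs : (d : ℝ) < s) :
    ∃ K > 0, ∀ x : Euc d, Summable (fun n : ↥X => (1 + ‖x - (n : Euc d)‖) ^ (-s)) ∧
      ∑' n : ↥X, (1 + ‖x - (n : Euc d)‖) ^ (-s) ≤ K := by
  classical
  obtain ⟨N, hN⟩ := hX
  have hs0 : 0 < s := (Nat.cast_nonneg d).trans_lt hs
  set v : ℝ := volume.real (Metric.ball (0 : Euc d) (1 / 2)) with hv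
  have hv0 : 0 < v :=
    ENNReal.toReal_pos (Metric.measure_ball_pos volume _ (by norm_num)).ne'
      measure_ball_lt_top.ne
  have hint : Integrable (fun y : Euc d => (1 + ‖y‖) ^ (-s)) :=
    integrable_one_add_norm (by simpa using hs)
  set I : ℝ := ∫ y : Euc d, (1 + ‖y‖) ^ (-s)
  have hI0 : 0 ≤ I := integral_nonneg fun y => by positivity
  have key : ∀ (x : Euc d) (t : Finset ↥X),
      ∑ n ∈ t, (1 + ‖x - (n : Euc d)‖) ^ (-s) ≤ N * (2 ^ s * I) / v := by
    intro x t
    rw [le_div_iff₀ hv0, Finset.sum_mul]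
    set g : Euc d → ℝ := fun y => 2 ^ s * (1 + ‖x - y‖) ^ (-s) with hg
    have hg0 : ∀ y, 0 ≤ g y := fun y => by positivity
    have hgint : Integrable g := (hint.comp_sub_left x).const_mul _
    have hgI : ∫ y, g y = 2 ^ s * I := by
      rw [hg, integral_const_mul, integral_sub_left_eq_self (fun y => (1 + ‖y‖) ^ (-s)) volume x]
    have hball : ∀ n : ↥X, (1 + ‖x - (n : Euc d)‖) ^ (-s) * v ≤
        ∫ y, (Metric.ball (n : Euc d) (1 / 2)).indicator g y := by
      intro n
      rw [integral_indicator Metric.isOpen_ball.measurableSet]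
      have hvn : volume.real (Metric.ball (n : Euc d) (1 / 2)) = v := by
        rw [hv, Measure.real, Measure.addHaar_ball_center, Measure.real]
      have hconst : (1 + ‖x - (n : Euc d)‖) ^ (-s) * v =
          ∫ _ in Metric.ball (n : Euc d) (1 / 2), (1 + ‖x - (n : Euc d)‖) ^ (-s) := by
        rw [setIntegral_const, hvn, smul_eq_mul, mul_comm]
      rw [hconst]
      refine setIntegral_mono_on (integrableOn_const measure_ball_lt_top.ne)
        hgint.integrableOn Metric.isOpen_ball.measurableSet fun y hy => ?_
      have hy' : ‖y - (n : Euc d)‖ < 1 / 2 := by simpa [dist_eq_norm] using hy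
      have h1 : 1 + ‖x - y‖ ≤ 2 * (1 + ‖x - (n : Euc d)‖) := by
        have := norm_sub_le_norm_sub_add_norm_sub x (n : Euc d) y
        rw [norm_sub_rev (n : Euc d) y] at this
        linarith [norm_nonneg (x - (n : Euc d))]
      calc (1 + ‖x - (n : Euc d)‖) ^ (-s)
          = 2 ^ s * (2 * (1 + ‖x - (n : Euc d)‖)) ^ (-s) := by
            rw [Real.mul_rpow (by norm_num) (by positivity), ← mul_assoc,
              ← Real.rpow_add (by norm_num)]
            simp
        _ ≤ g y := mul_le_mul_of_nonneg_left
            (Real.rpow_le_rpow_of_nonpos (by positivity) h1 (by linarith)) (by positivity)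
    have hoverlap : ∀ y, ∑ n ∈ t, (Metric.ball (n : Euc d) (1 / 2)).indicator g y ≤ N * g y := by
      intro y
      simp only [Set.indicator_apply]
      rw [← Finset.sum_filter, Finset.sum_const, nsmul_eq_mul]
      refine mul_le_mul_of_nonneg_right (Nat.cast_le.2 ?_) (hg0 y)
      obtain ⟨hfin, hcard⟩ := hN (WithLp.toLp 2 fun j => y j - 1 / 2)
      refine le_trans ?_ hcard
      rw [← Finset.card_map (Function.Embedding.subtype _), ← Set.ncard_coe_finset]
      refine Set.ncard_le_ncard ?_ hfin
      intro z hz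
      simp only [Finset.coe_map, Set.mem_image, Finset.mem_coe, Finset.mem_filter,
        Function.Embedding.subtype_apply] at hz
      obtain ⟨n, ⟨-, hn⟩, rfl⟩ := hz
      refine ⟨n.2, fun j => ?_⟩
      have h1 : ‖y - (n : Euc d)‖ < 1 / 2 := by simpa [dist_eq_norm] using hn
      have h2 : |y j - (n : Euc d) j| ≤ ‖y - (n : Euc d)‖ := by
        simpa using PiLp.norm_apply_le (y - (n : Euc d)) j
      have h3 := abs_le.1 (h2.trans h1.le)
      constructor <;> simp only <;> linarith [h3.1, h3.2]
    have hindint : ∀ n ∈ t, Integrable ((Metric.ball (n : Euc d) (1 / 2)).indicator g) :=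
      fun n _ => hgint.indicator Metric.isOpen_ball.measurableSet
    calc ∑ n ∈ t, (1 + ‖x - (n : Euc d)‖) ^ (-s) * v
        ≤ ∑ n ∈ t, ∫ y, (Metric.ball (n : Euc d) (1 / 2)).indicator g y :=
          Finset.sum_le_sum fun n _ => hball n
      _ = ∫ y, ∑ n ∈ t, (Metric.ball (n : Euc d) (1 / 2)).indicator g y :=
          (integral_finsetSum t hindint).symm
      _ ≤ ∫ y, N * g y :=
          integral_mono (integrable_finsetSum t hindint) (hgint.const_mul _) hoverlap
      _ = N * (2 ^ s * I) := by rw [integral_const_mul, hgI]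
  refine ⟨N * (2 ^ s * I) / v + 1, by positivity, fun x => ?_⟩
  have hnn : ∀ n : ↥X, 0 ≤ (1 + ‖x - (n : Euc d)‖) ^ (-s) := fun n => by positivity
  exact ⟨summable_of_sum_le hnn (key x),
    (Real.tsum_le_of_sum_le hnn (key x)).trans (by linarith)⟩

/-- A matrix entry is bounded by the Jaffard norm times the polynomial off-diagonal decay. -/
theorem norm_le_jaffardNorm_mul {d : ℕ} {X : Set (Euc d)} {H : Type*}
    [NormedAddCommGroup H] [InnerProductSpace ℂ H] {s : ℝ} {A : ↥X → ↥X → (H →L[ℂ] H)}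
    (hA : BddAbove (Set.range fun q : ↥X × ↥X =>
      ‖A q.1 q.2‖ * (1 + ‖(q.1 : Euc d) - (q.2 : Euc d)‖) ^ s)) (k l : ↥X) :
    ‖A k l‖ ≤ jaffardNorm s A * (1 + ‖(k : Euc d) - (l : Euc d)‖) ^ (-s) := by
  have h := le_ciSup hA (k, l)
  rw [Real.rpow_neg (by positivity), ← div_eq_mul_inv, le_div_iff₀ (by positivity)]
  exact h

/-- The Jaffard norm is nonnegative. -/
theorem jaffardNorm_nonneg {d : ℕ} {X : Set (Euc d)} {H : Type*}
    [NormedAddCommGroup H] [InnerProductSpace ℂ H] (s : ℝ) (A : ↥X → ↥X → (H →L[ℂ] H)) :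
    0 ≤ jaffardNorm s A :=
  Real.iSup_nonneg fun q => by positivity

/-- Subconvolutivity of the weight `(1 + r) ^ (-s)` in terms of lengths satisfying a triangle
inequality. -/
theorem one_add_rpow_mul_rpow_neg_mul_rpow_neg_le {s p q r : ℝ} (hs : 0 ≤ s) (hp : 0 ≤ p)
    (hq : 0 ≤ q) (hr : 0 ≤ r) (h : r ≤ p + q) :
    (1 + p) ^ (-s) * (1 + q) ^ (-s) * (1 + r) ^ s ≤
      2 ^ s * ((1 + p) ^ (-s) + (1 + q) ^ (-s)) := by
  wlog hpq : p ≤ q generalizing p q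
  · have := this hq hp (by linarith) (by linarith)
    rwa [mul_comm ((1 + q) ^ (-s)), add_comm ((1 + q) ^ (-s))] at this
  have h1 : (1 + r) ^ s ≤ 2 ^ s * (1 + q) ^ s := by
    rw [← Real.mul_rpow (by norm_num) (by positivity)]
    exact Real.rpow_le_rpow (by positivity) (by linarith) hs
  have h2 : (1 + q) ^ (-s) * (1 + q) ^ s = 1 := by
    rw [← Real.rpow_add (by positivity)]
    simp
  calc (1 + p) ^ (-s) * (1 + q) ^ (-s) * (1 + r) ^ s
      ≤ (1 + p) ^ (-s) * (1 + q) ^ (-s) * (2 ^ s * (1 + q) ^ s) := by gcongr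
    _ = 2 ^ s * (1 + p) ^ (-s) * ((1 + q) ^ (-s) * (1 + q) ^ s) := by ring
    _ = 2 ^ s * (1 + p) ^ (-s) := by rw [h2, mul_one]
    _ ≤ 2 ^ s * ((1 + p) ^ (-s) + (1 + q) ^ (-s)) := by
        gcongr
        exact le_add_of_nonneg_right (by positivity)

theorem statement2 {d : ℕ} (X : Set (Euc d)) (hX : RelSep X)
    (H : Type*) [NormedAddCommGroup H] [InnerProductSpace ℂ H] [CompleteSpace H]
    [TopologicalSpace.SeparableSpace H]
    (s : ℝ) (hs : (d : ℝ) < s) :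
    ∃ C > 0, ∀ A B : ↥X → ↥X → (H →L[ℂ] H),
      BddAbove (Set.range fun q : ↥X × ↥X =>
        ‖A q.1 q.2‖ * (1 + ‖(q.1 : Euc d) - (q.2 : Euc d)‖) ^ s) →
      BddAbove (Set.range fun q : ↥X × ↥X =>
        ‖B q.1 q.2‖ * (1 + ‖(q.1 : Euc d) - (q.2 : Euc d)‖) ^ s) →
      ∀ k l : ↥X,
        Summable (fun n : ↥X => ‖(A k n) ∘L (B n l)‖) ∧
        ‖∑' n : ↥X, (A k n) ∘L (B n l)‖ * (1 + ‖(k : Euc d) - (l : Euc d)‖) ^ s ≤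
          C * jaffardNorm s A * jaffardNorm s B := by
  have hs0 : 0 ≤ s := (Nat.cast_nonneg d).trans hs.le
  obtain ⟨K, hK0, hK⟩ := hX.exists_tsum_one_add_norm_rpow_le hs
  refine ⟨2 ^ s * (K + K), by positivity, fun A B hA hB k l => ?_⟩
  set a := jaffardNorm s A
  set b := jaffardNorm s B
  have ha : 0 ≤ a := jaffardNorm_nonneg s A
  have hb : 0 ≤ b := jaffardNorm_nonneg s B
  set w : ℝ := (1 + ‖(k : Euc d) - (l : Euc d)‖) ^ s
  have hw : 1 ≤ w := Real.one_le_rpow (by linarith [norm_nonneg ((k : Euc d) - (l : Euc d))]) hs0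
  set f : ↥X → ℝ := fun n => a * b * (2 ^ s *
    ((1 + ‖(k : Euc d) - (n : Euc d)‖) ^ (-s) + (1 + ‖(l : Euc d) - (n : Euc d)‖) ^ (-s)))
  have hf : Summable f := (((hK k).1.add (hK l).1).mul_left _).mul_left _
  have hfK : ∑' n, f n ≤ 2 ^ s * (K + K) * a * b := by
    rw [tsum_mul_left, tsum_mul_left, (hK k).1.tsum_add (hK l).1]
    calc _ ≤ a * b * (2 ^ s * (K + K)) := by
          gcongr
          exacts [(hK k).2, (hK l).2]
      _ = _ := by ring
  have hterm : ∀ n : ↥X, ‖(A k n) ∘L (B n l)‖ * w ≤ f n := by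
    intro n
    have hBn := norm_le_jaffardNorm_mul hB n l
    rw [norm_sub_rev] at hBn
    have htri : ‖(k : Euc d) - (l : Euc d)‖ ≤
        ‖(k : Euc d) - (n : Euc d)‖ + ‖(l : Euc d) - (n : Euc d)‖ := by
      rw [norm_sub_rev (l : Euc d)]
      exact norm_sub_le_norm_sub_add_norm_sub _ _ _
    calc ‖(A k n) ∘L (B n l)‖ * w
        ≤ ‖A k n‖ * ‖B n l‖ * w := by
          gcongr
          exact ContinuousLinearMap.opNorm_comp_le _ _
      _ ≤ a * (1 + ‖(k : Euc d) - (n : Euc d)‖) ^ (-s) *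
            (b * (1 + ‖(l : Euc d) - (n : Euc d)‖) ^ (-s)) * w := by
          gcongr
          exact norm_le_jaffardNorm_mul hA k n
      _ = a * b * ((1 + ‖(k : Euc d) - (n : Euc d)‖) ^ (-s) *
            (1 + ‖(l : Euc d) - (n : Euc d)‖) ^ (-s) * w) := by ring
      _ ≤ f n := mul_le_mul_of_nonneg_left
          (one_add_rpow_mul_rpow_neg_mul_rpow_neg_le hs0 (norm_nonneg _) (norm_nonneg _)
            (norm_nonneg _) htri) (by positivity)
  have hsum : Summable fun n : ↥X => ‖(A k n) ∘L (B n l)‖ :=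
    hf.of_nonneg_of_le (fun n => norm_nonneg _) fun n =>
      (le_mul_of_one_le_right (norm_nonneg _) hw).trans (hterm n)
  refine ⟨hsum, ?_⟩
  calc ‖∑' n : ↥X, (A k n) ∘L (B n l)‖ * w
      ≤ (∑' n : ↥X, ‖(A k n) ∘L (B n l)‖) * w := by
        gcongr
        exact norm_tsum_le_tsum_norm hsum
    _ = ∑' n : ↥X, ‖(A k n) ∘L (B n l)‖ * w := tsum_mul_right.symm
    _ ≤ ∑' n, f n := (hsum.mul_right w).tsum_le_tsum hterm hf
    _ ≤ 2 ^ s * (K + K) * a * b := hfK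
end
end

section
/- Let X ⊂ ℝ^d be a relatively separated set and s > d. The Jaffard algebra J_s(X) is inverse-closed in B(ℓ²(X;H)): if A = [A_{k,l}]_{k,l∈X} is a B(H)-valued matrix with finite Jaffard norm sup_{k,l∈X} ‖A_{k,l}‖ (1+|k−l|)^s < ∞, and the bounded operator on ℓ²(X;H) defined by A is invertible in B(ℓ²(X;H)), then the canonical matrix representation [B_{k,l}]_{k,l∈X} of the inverse operator A^{−1} also has finite Jaffard norm, i.e. sup_{k,l∈X} ‖B_{k,l}‖ (1+|k−l|)^s < ∞. -/
open scoped ENNReal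
open Set

noncomputable section

/-- The sequence `δ_l f ∈ ℓ^p(X;H)` equal to `f` at index `l` and `0` elsewhere. -/
noncomputable def deltaSeq {X : Type*} {H : Type*} [NormedAddCommGroup H]
    (p : ℝ≥0∞) (l : X) (f : H) : lp (fun _ : X => H) p :=
  haveI := Classical.decEq X
  lp.single p l f

theorem deltaSeq_self {X H : Type*} [NormedAddCommGroup H] (p : ℝ≥0∞) (l : X) (f : H) :
    deltaSeq p l f l = f := by
  let := Classical.decEq X
  exact lp.single_apply_self _ _ _

theorem deltaSeq_of_ne {X H : Type*} [NormedAddCommGroup H] (p : ℝ≥0∞) {k l : X} (f : H)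
    (h : k ≠ l) : deltaSeq p l f k = 0 := by
  let := Classical.decEq X
  exact lp.single_apply_ne _ _ _ h

theorem norm_deltaSeq {X H : Type*} [NormedAddCommGroup H] (l : X) (f : H) :
    ‖deltaSeq 2 l f‖ = ‖f‖ := by
  let := Classical.decEq X
  exact lp.norm_single (by norm_num) _ _

theorem hasSum_deltaSeq {X H : Type*} [NormedAddCommGroup H] (g : lp (fun _ : X => H) 2) :
    HasSum (fun m => deltaSeq 2 m (g m)) g := by
  let := Classical.decEq X
  exact lp.hasSum_single (E := fun _ : X => H) (p := 2) (by norm_num) g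

theorem inner_deltaSeq_left {X H : Type*} [NormedAddCommGroup H] [InnerProductSpace ℂ H]
    (l : X) (f : H) (g : lp (fun _ : X => H) 2) :
    inner ℂ (deltaSeq 2 l f) g = inner ℂ f (g l) := by
  let := Classical.decEq X
  exact lp.inner_single_left (𝕜 := ℂ) (G := fun _ : X => H) l f g

theorem inner_deltaSeq_right {X H : Type*} [NormedAddCommGroup H] [InnerProductSpace ℂ H]
    (l : X) (f : H) (g : lp (fun _ : X => H) 2) :
    inner ℂ g (deltaSeq 2 l f) = inner ℂ (g l) f := by
  let := Classical.decEq X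
  exact lp.inner_single_right (𝕜 := ℂ) (G := fun _ : X => H) l f g

theorem tendsto_sub_pow_mul {A : Type*} [NormedRing A] {p : A} (hp : ‖p‖ < 1) (q : A) :
    Filter.Tendsto (fun n : ℕ => q - p ^ n * q) Filter.atTop (nhds q) := by
  simpa using ((tendsto_pow_atTop_nhds_zero_of_norm_lt_one hp).mul_const q).const_sub q

section OffDiagonal

variable {X : Type*} [PseudoMetricSpace X] {H : Type*} [NormedAddCommGroup H]
  [InnerProductSpace ℂ H]

/-- The matrix entries of `U` are bounded in norm by `a * (1 + dist k l) ^ (-s)`. -/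
def OffDiagBound (s a : ℝ) (U : lp (fun _ : X => H) 2 →L[ℂ] lp (fun _ : X => H) 2) : Prop :=
  ∀ (k l : X) (f : H), ‖U (deltaSeq 2 l f) k‖ ≤ a * (1 + dist k l) ^ (-s) * ‖f‖

theorem norm_le_of_hasSum_of_sum_le {H' : Type*} [NormedAddCommGroup H'] {ι : Type*}
    {u : ι → H'} {x : H'}
    (hu : HasSum u x) {b : ι → ℝ} (hb : ∀ i, ‖u i‖ ≤ b i) {M : ℝ}
    (hM : ∀ F : Finset ι, ∑ i ∈ F, b i ≤ M) : ‖x‖ ≤ M :=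
  le_of_tendsto hu.norm <| Filter.Eventually.of_forall fun F =>
    (norm_sum_le _ _).trans ((Finset.sum_le_sum fun i _ => hb i).trans (hM F))

theorem one_le_one_add_dist (k l : X) : 1 ≤ 1 + dist k l := by
  linarith [dist_nonneg (x := k) (y := l)]

theorem rpow_weight_pos (k l : X) (s : ℝ) : 0 < (1 + dist k l) ^ s :=
  Real.rpow_pos_of_pos (by linarith [one_le_one_add_dist k l]) _

theorem one_le_weight_mul {s : ℝ} (hs : 0 ≤ s) (k m l : X) :
    1 ≤ 2 ^ s * (1 + dist k l) ^ (-s) * ((1 + dist k m) ^ s + (1 + dist m l) ^ s) := by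
  have h1 := one_le_one_add_dist k m
  have h2 := one_le_one_add_dist m l
  have h3 := one_le_one_add_dist k l
  have p1 := rpow_weight_pos k m s
  have p2 := rpow_weight_pos m l s
  have p3 := rpow_weight_pos k l s
  have htri := dist_triangle k m l
  have key : (1 + dist k l) ^ s ≤ 2 ^ s * ((1 + dist k m) ^ s + (1 + dist m l) ^ s) := by
    rcases le_total (dist k m) (dist m l) with h | h
    · calc (1 + dist k l) ^ s ≤ (2 * (1 + dist m l)) ^ s :=
            Real.rpow_le_rpow (by linarith) (by linarith) hs
        _ = 2 ^ s * (1 + dist m l) ^ s := Real.mul_rpow (by norm_num) (by linarith)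
        _ ≤ _ := by gcongr; linarith
    · calc (1 + dist k l) ^ s ≤ (2 * (1 + dist k m)) ^ s :=
            Real.rpow_le_rpow (by linarith) (by linarith) hs
        _ = 2 ^ s * (1 + dist k m) ^ s := Real.mul_rpow (by norm_num) (by linarith)
        _ ≤ _ := by gcongr; linarith
  rw [Real.rpow_neg (by linarith), mul_right_comm, ← div_eq_mul_inv, one_le_div p3]
  exact key

namespace OffDiagBound

variable {s t a a' b b' : ℝ} {U V : lp (fun _ : X => H) 2 →L[ℂ] lp (fun _ : X => H) 2}

theorem mono (h : OffDiagBound s a U) (hab : a ≤ b) : OffDiagBound s b U := fun k l f =>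
  (h k l f).trans (by have := rpow_weight_pos k l (-s); gcongr)

theorem of_exponent_le (h : OffDiagBound s a U) (ha : 0 ≤ a) (hts : t ≤ s) :
    OffDiagBound t a U := fun k l f =>
  (h k l f).trans (by
    have := Real.rpow_le_rpow_of_exponent_le (one_le_one_add_dist k l) (neg_le_neg hts)
    gcongr)

theorem zero (s : ℝ) : OffDiagBound s 0 (0 : lp (fun _ : X => H) 2 →L[ℂ] lp (fun _ : X => H) 2) :=
  fun k l f => by simp

theorem one (s : ℝ) : OffDiagBound s 1 (1 : lp (fun _ : X => H) 2 →L[ℂ] lp (fun _ : X => H) 2) := by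
  intro k l f
  rw [one_apply_eq_self]
  by_cases h : k = l
  · subst h; simp [deltaSeq_self]
  · rw [deltaSeq_of_ne 2 f h, norm_zero]
    have := rpow_weight_pos k l (-s)
    positivity

theorem add (hU : OffDiagBound s a U) (hV : OffDiagBound s b V) :
    OffDiagBound s (a + b) (U + V) := fun k l f => by
  have := norm_add_le (U (deltaSeq 2 l f) k) (V (deltaSeq 2 l f) k)
  rw [add_apply, lp.coeFn_add, Pi.add_apply]
  linarith [hU k l f, hV k l f]

theorem smul (c : ℂ) (hU : OffDiagBound s a U) : OffDiagBound s (‖c‖ * a) (c • U) := fun k l f => by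
  rw [smul_apply, lp.coeFn_smul, Pi.smul_apply, norm_smul]
  have := mul_le_mul_of_nonneg_left (hU k l f) (norm_nonneg c)
  linarith

theorem adjoint [CompleteSpace H] (hU : OffDiagBound s a U) :
    OffDiagBound s a (ContinuousLinearMap.adjoint U) := by
  intro k l f
  set h := ContinuousLinearMap.adjoint U (deltaSeq 2 l f) k with hh
  have e : inner ℂ h h = inner ℂ (U (deltaSeq 2 k h) l) f := by
    calc inner ℂ h h = inner ℂ (deltaSeq 2 k h) (ContinuousLinearMap.adjoint U (deltaSeq 2 l f)) :=
          (inner_deltaSeq_left _ _ _).symm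
      _ = inner ℂ (U (deltaSeq 2 k h)) (deltaSeq 2 l f) :=
          ContinuousLinearMap.adjoint_inner_right _ _ _
      _ = _ := inner_deltaSeq_right _ _ _
  have h1 : ‖h‖ * ‖h‖ ≤ a * (1 + dist k l) ^ (-s) * ‖f‖ * ‖h‖ := by
    calc ‖h‖ * ‖h‖ = ‖inner ℂ h h‖ := by rw [inner_self_eq_norm_sq_to_K]; simp [sq]
      _ ≤ ‖U (deltaSeq 2 k h) l‖ * ‖f‖ := by rw [e]; exact norm_inner_le_norm _ _
      _ ≤ a * (1 + dist l k) ^ (-s) * ‖h‖ * ‖f‖ := by gcongr; exact hU l k h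
      _ = _ := by rw [dist_comm l k]; ring
  rcases (norm_nonneg h).eq_or_lt with h0 | h0
  · rw [← h0]
    rcases (norm_nonneg f).eq_or_lt with f0 | f0
    · rw [← f0]; simp
    · have := (norm_nonneg _).trans (hU k l f)
      exact this
  · exact le_of_mul_le_mul_right h1 h0

/-- Products of matrices with off-diagonal decay; each term of the bound uses only one of the
decay constants of order `s`, paired with one of the summable order `t`. -/
theorem mul {M : ℝ} (hs : 0 ≤ s)
    (hM : ∀ (k : X) (F : Finset X), ∑ m ∈ F, (1 + dist k m) ^ (-t) ≤ M)
    (ha : 0 ≤ a) (ha' : 0 ≤ a') (hb : 0 ≤ b) (hb' : 0 ≤ b')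
    (hU : OffDiagBound s a U) (hU' : OffDiagBound t a' U)
    (hV : OffDiagBound s b V) (hV' : OffDiagBound t b' V) :
    OffDiagBound s (2 ^ s * M * (a * b' + a' * b)) (U * V) := by
  intro k l f
  have hsum : HasSum (fun m => U (deltaSeq 2 m (V (deltaSeq 2 l f) m)) k)
      ((U * V) (deltaSeq 2 l f) k) :=
    ((hasSum_deltaSeq (V (deltaSeq 2 l f))).mapL U).mapL (lp.evalCLM ℂ (fun _ : X => H) 2 k)
  refine norm_le_of_hasSum_of_sum_le hsum (b := fun m => 2 ^ s * (1 + dist k l) ^ (-s) * ‖f‖ *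
    (a' * b * (1 + dist k m) ^ (-t) + a * b' * (1 + dist l m) ^ (-t))) ?_ ?_
  · intro m
    set g := V (deltaSeq 2 l f) m
    set x := ‖U (deltaSeq 2 m g) k‖
    have hx : 0 ≤ x := norm_nonneg _
    have q1 := rpow_weight_pos k m s
    have q2 := rpow_weight_pos m l s
    have q3 := rpow_weight_pos k m (-t)
    have q4 := rpow_weight_pos k l (-s)
    have cancel : ∀ i j : X, (1 + dist i j) ^ (-s) * (1 + dist i j) ^ s = 1 := fun i j => by
      rw [← Real.rpow_add (by linarith [one_le_one_add_dist i j])]; simp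
    have h1 : x * (1 + dist k m) ^ s ≤ a * b' * (1 + dist l m) ^ (-t) * ‖f‖ := by
      calc x * (1 + dist k m) ^ s
          ≤ (a * (1 + dist k m) ^ (-s) * ‖g‖) * (1 + dist k m) ^ s := by gcongr; exact hU k m g
        _ = a * ‖g‖ * ((1 + dist k m) ^ (-s) * (1 + dist k m) ^ s) := by ring
        _ ≤ a * (b' * (1 + dist m l) ^ (-t) * ‖f‖) := by
          rw [cancel, mul_one]; gcongr; exact hV' m l f
        _ = _ := by rw [dist_comm m l]; ring
    have h2 : x * (1 + dist m l) ^ s ≤ a' * b * (1 + dist k m) ^ (-t) * ‖f‖ := by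
      calc x * (1 + dist m l) ^ s
          ≤ (a' * (1 + dist k m) ^ (-t) * ‖g‖) * (1 + dist m l) ^ s := by gcongr; exact hU' k m g
        _ ≤ (a' * (1 + dist k m) ^ (-t) * (b * (1 + dist m l) ^ (-s) * ‖f‖)) *
              (1 + dist m l) ^ s := by gcongr; exact hV m l f
        _ = a' * (1 + dist k m) ^ (-t) * b * ‖f‖ *
              ((1 + dist m l) ^ (-s) * (1 + dist m l) ^ s) := by ring
        _ = _ := by rw [cancel]; ring
    calc x ≤ x * (2 ^ s * (1 + dist k l) ^ (-s) * ((1 + dist k m) ^ s + (1 + dist m l) ^ s)) :=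
          le_mul_of_one_le_right hx (one_le_weight_mul hs k m l)
      _ = 2 ^ s * (1 + dist k l) ^ (-s) * (x * (1 + dist k m) ^ s + x * (1 + dist m l) ^ s) := by
          ring
      _ ≤ 2 ^ s * (1 + dist k l) ^ (-s) * (a * b' * (1 + dist l m) ^ (-t) * ‖f‖ +
            a' * b * (1 + dist k m) ^ (-t) * ‖f‖) := by gcongr
      _ = _ := by ring
  · intro F
    have h1 := hM k F
    have h2 := hM l F
    rw [← Finset.mul_sum, Finset.sum_add_distrib, ← Finset.mul_sum, ← Finset.mul_sum]
    have := rpow_weight_pos k l (-s)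
    calc _ ≤ 2 ^ s * (1 + dist k l) ^ (-s) * ‖f‖ * (a' * b * M + a * b' * M) := by gcongr
      _ = _ := by ring

theorem exponent_mul {u α : ℝ} (hα0 : 0 ≤ α) (hα1 : α ≤ 1) (ha : 0 ≤ a) (hu : ‖U‖ ≤ u)
    (hU : OffDiagBound s a U) : OffDiagBound (α * s) (a ^ α * u ^ (1 - α)) U := by
  intro k l f
  set x := ‖U (deltaSeq 2 l f) k‖
  have hx0 : 0 ≤ x := norm_nonneg _
  have hu0 : 0 ≤ u := (norm_nonneg U).trans hu
  have hw := rpow_weight_pos k l (-s)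
  have h1 : x ≤ u * ‖f‖ := by
    calc x ≤ ‖U (deltaSeq 2 l f)‖ := lp.norm_apply_le_norm (by norm_num) _ _
      _ ≤ u * ‖deltaSeq 2 l f‖ := U.le_of_opNorm_le hu _
      _ = _ := by rw [norm_deltaSeq]
  have e : ∀ y : ℝ, 0 ≤ y → y = y ^ α * y ^ (1 - α) := fun y hy => by
    rw [← Real.rpow_add_of_nonneg hy hα0 (by linarith)]; simp
  calc x = x ^ α * x ^ (1 - α) := e x hx0
    _ ≤ (a * (1 + dist k l) ^ (-s) * ‖f‖) ^ α * (u * ‖f‖) ^ (1 - α) := by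
        gcongr
        exact hU k l f
    _ = a ^ α * u ^ (1 - α) * (1 + dist k l) ^ (-(α * s)) * (‖f‖ ^ α * ‖f‖ ^ (1 - α)) := by
        rw [Real.mul_rpow (by positivity) (norm_nonneg _), Real.mul_rpow ha hw.le,
          Real.mul_rpow hu0 (norm_nonneg _),
          ← Real.rpow_mul (by linarith [one_le_one_add_dist k l])]
        ring_nf
    _ = _ := by rw [← e _ (norm_nonneg f)]

theorem of_tendsto {ι : Type*} {l : Filter ι} [l.NeBot]
    {W : ι → lp (fun _ : X => H) 2 →L[ℂ] lp (fun _ : X => H) 2}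
    (hW : Filter.Tendsto W l (nhds U)) (h : ∀ i, OffDiagBound s a (W i)) :
    OffDiagBound s a U := fun k m f => by
  have h1 : Filter.Tendsto (fun i => W i (deltaSeq 2 m f) k) l
      (nhds (U (deltaSeq 2 m f) k)) :=
    (((lp.evalCLM ℂ (fun _ : X => H) 2 k).continuous.comp
      (ContinuousLinearMap.apply ℂ _ (deltaSeq 2 m f)).continuous).tendsto U).comp hW
  exact le_of_tendsto h1.norm (Filter.Eventually.of_forall fun i => h i k m f)

theorem mul_of_exponent_le {M : ℝ} (hs : 0 ≤ s) (hts : t ≤ s)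
    (hM : ∀ (k : X) (F : Finset X), ∑ m ∈ F, (1 + dist k m) ^ (-t) ≤ M)
    (ha : 0 ≤ a) (hb : 0 ≤ b) (hU : OffDiagBound s a U) (hV : OffDiagBound s b V) :
    OffDiagBound s (2 * 2 ^ s * M * a * b) (U * V) :=
  (mul hs hM ha ha hb hb hU (hU.of_exponent_le ha hts) hV (hV.of_exponent_le hb hts)).mono
    (by linarith)

theorem exists_pow {M : ℝ} (hs : 0 ≤ s) (hts : t ≤ s) (hM0 : 0 ≤ M)
    (hM : ∀ (k : X) (F : Finset X), ∑ m ∈ F, (1 + dist k m) ^ (-t) ≤ M)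
    (ha : 0 ≤ a) (hU : OffDiagBound s a U) (n : ℕ) :
    ∃ b, 0 ≤ b ∧ OffDiagBound s b (U ^ n) := by
  induction n with
  | zero => exact ⟨1, zero_le_one, by rw [pow_zero]; exact one s⟩
  | succ n ih =>
    obtain ⟨b, hb, h⟩ := ih
    refine ⟨_, ?_, by rw [pow_succ]; exact mul_of_exponent_le hs hts hM hb ha h hU⟩
    positivity

theorem exists_geom_sum {M : ℝ} (hs : 0 ≤ s) (hts : t ≤ s) (hM0 : 0 ≤ M)
    (hM : ∀ (k : X) (F : Finset X), ∑ m ∈ F, (1 + dist k m) ^ (-t) ≤ M)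
    (ha : 0 ≤ a) (hU : OffDiagBound s a U) (n : ℕ) :
    ∃ b, 0 ≤ b ∧ OffDiagBound s b (∑ i ∈ Finset.range n, U ^ i) := by
  induction n with
  | zero => exact ⟨0, le_rfl, by rw [Finset.sum_range_zero]; exact zero s⟩
  | succ n ih =>
    obtain ⟨b, hb, h⟩ := ih
    obtain ⟨c, hc, h'⟩ := exists_pow hs hts hM0 hM ha hU n
    exact ⟨b + c, add_nonneg hb hc, by rw [Finset.sum_range_succ]; exact h.add h'⟩

/-- Repeated squaring of an operator with norm at most `exp L`. -/
theorem pow_two_pow {M L c D α : ℝ} (hs : 0 ≤ s) (hα0 : 0 < α) (hα1 : α ≤ 1)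
    (hM : ∀ (k : X) (F : Finset X), ∑ m ∈ F, (1 + dist k m) ^ (-(α * s)) ≤ M)
    (hc : 2 * 2 ^ s * M ≤ Real.exp c) (hL : ‖U‖ ≤ Real.exp L)
    (hU : OffDiagBound s (Real.exp (L + D - c / α)) U) (j : ℕ) :
    OffDiagBound s (Real.exp (L * 2 ^ j + D * (1 + α) ^ j - c / α)) (U ^ 2 ^ j) := by
  induction j with
  | zero => simpa using hU
  | succ j ih =>
    have hn : ‖U ^ 2 ^ j‖ ≤ Real.exp (L * 2 ^ j) := by
      calc ‖U ^ 2 ^ j‖ ≤ ‖U‖ ^ 2 ^ j := norm_pow_le' U (by positivity)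
        _ ≤ Real.exp L ^ 2 ^ j := by gcongr
        _ = _ := by rw [← Real.exp_nat_mul]; push_cast; ring_nf
    have h' := ih.exponent_mul hα0.le hα1 (Real.exp_pos _).le hn
    have h := mul hs hM (Real.exp_pos _).le (by positivity) (Real.exp_pos _).le (by positivity)
      ih h' ih h'
    rw [show U ^ 2 ^ (j + 1) = U ^ 2 ^ j * U ^ 2 ^ j by rw [pow_succ (2 : ℕ) j, pow_mul, sq]]
    refine h.mono ?_
    rw [← Real.exp_mul, ← Real.exp_mul, ← Real.exp_add]
    set p := L * 2 ^ j + D * (1 + α) ^ j - c / α with hp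
    set q := p * α + L * 2 ^ j * (1 - α) with hq
    calc 2 ^ s * M * (Real.exp p * Real.exp q + Real.exp q * Real.exp p)
        = 2 * 2 ^ s * M * (Real.exp p * Real.exp q) := by ring
      _ ≤ Real.exp c * (Real.exp p * Real.exp q) := by gcongr
      _ = Real.exp (L * 2 ^ (j + 1) + D * (1 + α) ^ (j + 1) - c / α) := by
        rw [← Real.exp_add, ← Real.exp_add, hq, hp]
        congr 1
        field_simp
        ring

theorem tendsto_exp_repeated_squaring {L D α e : ℝ} (hL : L < 0) (hα0 : 0 < α) (hα1 : α < 1) :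
    Filter.Tendsto (fun j : ℕ => Real.exp (L * 2 ^ j + D * (1 + α) ^ j - e))
      Filter.atTop (nhds 0) := by
  refine Real.tendsto_exp_atBot.comp ?_
  have h1 : Filter.Tendsto (fun j : ℕ => (1 + α) ^ j) Filter.atTop Filter.atTop :=
    tendsto_pow_atTop_atTop_of_one_lt (by linarith)
  have h2 : Filter.Tendsto (fun j : ℕ => (2 / (1 + α)) ^ j) Filter.atTop Filter.atTop :=
    tendsto_pow_atTop_atTop_of_one_lt (by rw [one_lt_div] <;> linarith)
  have h3 := Filter.tendsto_atBot_add_const_right _ D (h2.const_mul_atTop_of_neg hL)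
  have h4 := Filter.tendsto_atBot_add_const_right _ (-e) (h1.atTop_mul_atBot₀ h3)
  refine h4.congr fun j => ?_
  rw [div_pow]
  field_simp
  ring

/-- A power of a strict contraction with off-diagonal decay has arbitrarily small decay constant. -/
theorem exists_pow_le {M α ε : ℝ} (hs : 0 ≤ s) (hα0 : 0 < α) (hα1 : α < 1) (hM0 : 0 ≤ M)
    (hM : ∀ (k : X) (F : Finset X), ∑ m ∈ F, (1 + dist k m) ^ (-(α * s)) ≤ M)
    {r : ℝ} (hr0 : 0 < r) (hr1 : r < 1) (hr : ‖U‖ ≤ r) (ha : 0 ≤ a)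
    (hU : OffDiagBound s a U) (hε : 0 < ε) :
    ∃ n, n ≠ 0 ∧ OffDiagBound s ε (U ^ n) := by
  set L := Real.log r
  set c := Real.log (2 * 2 ^ s * M + 1)
  set D := Real.log (a + 1) - L + c / α with hD
  have hL : Real.exp L = r := Real.exp_log hr0
  have hc : 2 * 2 ^ s * M ≤ Real.exp c := by
    rw [Real.exp_log (by positivity)]; linarith
  have hU' : OffDiagBound s (Real.exp (L + D - c / α)) U := by
    refine hU.mono ?_
    rw [show L + D - c / α = Real.log (a + 1) by rw [hD]; ring, Real.exp_log (by linarith)]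
    linarith
  obtain ⟨j, hj⟩ := ((tendsto_exp_repeated_squaring (D := D) (e := c / α)
    (Real.log_neg hr0 hr1) hα0 hα1).eventually_lt_const hε).exists
  exact ⟨2 ^ j, by positivity, (pow_two_pow hs hα0 hα1.le hM hc (hr.trans hL.ge) hU' j).mono hj.le⟩

/-- The inverse of `1 - U`, for a strict contraction `U`, inherits off-diagonal decay. -/
theorem exists_inverse_one_sub {M α : ℝ} (hs : 0 ≤ s) (hα0 : 0 < α) (hα1 : α < 1) (hM0 : 0 ≤ M)
    (hM : ∀ (k : X) (F : Finset X), ∑ m ∈ F, (1 + dist k m) ^ (-(α * s)) ≤ M)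
    {r : ℝ} (hr0 : 0 < r) (hr1 : r < 1) (hr : ‖U‖ ≤ r) (ha : 0 ≤ a)
    (hU : OffDiagBound s a U) {Q : lp (fun _ : X => H) 2 →L[ℂ] lp (fun _ : X => H) 2}
    (hQ : (1 - U) * Q = 1) :
    ∃ b, 0 ≤ b ∧ OffDiagBound s b Q := by
  have hts : α * s ≤ s := mul_le_of_le_one_left hs hα1.le
  obtain ⟨n, hn, hP⟩ := exists_pow_le hs hα0 hα1 hM0 hM hr0 hr1 hr ha hU
    (ε := 1 / (2 * (2 * 2 ^ s * M + 1))) (by positivity)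
  obtain ⟨b, hb, hW⟩ := exists_geom_sum hs hts hM0 hM ha hU n
  set W := ∑ i ∈ Finset.range n, U ^ i
  set P := U ^ n
  have hPn : ‖P‖ < 1 := by
    calc ‖P‖ ≤ ‖U‖ ^ n := norm_pow_le' U (Nat.pos_of_ne_zero hn)
      _ ≤ r ^ n := by gcongr
      _ < 1 := pow_lt_one₀ hr0.le hr1 hn
  have hQW : Q = W + P * Q := by
    have h1 : W * (1 - U) = 1 - P := geom_sum_mul_neg U n
    have h2 : W * ((1 - U) * Q) = Q - P * Q := by rw [← mul_assoc, h1, sub_mul, one_mul]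
    rw [hQ, mul_one] at h2
    rw [h2]; abel
  have hind : ∀ i : ℕ, OffDiagBound s (2 * b) (Q - P ^ i * Q) := by
    intro i
    induction i with
    | zero =>
      rw [pow_zero, one_mul, sub_self]
      exact (zero s).mono (by linarith)
    | succ i ih =>
      have e : Q - P ^ (i + 1) * Q = W + P * (Q - P ^ i * Q) := by
        rw [mul_sub, ← mul_assoc, ← pow_succ']
        nth_rewrite 1 [hQW]
        abel
      rw [e]
      refine (hW.add (mul_of_exponent_le hs hts hM (by positivity) (by positivity) hP ih)).mono ?_
      have : 2 * 2 ^ s * M * (1 / (2 * (2 * 2 ^ s * M + 1))) ≤ 1 / 2 := by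
        have : 0 ≤ 2 * 2 ^ s * M := by positivity
        rw [mul_one_div, div_le_div_iff₀ (by positivity) (by norm_num)]
        linarith
      nlinarith
  refine ⟨2 * b, by linarith, of_tendsto (tendsto_sub_pow_mul hPn Q) hind⟩

end OffDiagBound

end OffDiagonal

/-- If `S` is a left inverse of `T`, then `1 - c T* T` is a strict contraction for small `c`. -/
theorem exists_norm_one_sub_smul_adjoint_mul_self_le {E : Type*} [NormedAddCommGroup E]
    [InnerProductSpace ℂ E] [CompleteSpace E] (S T : E →L[ℂ] E) (hST : S * T = 1) :
    ∃ c r : ℝ, 0 < c ∧ 0 < r ∧ r < 1 ∧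
      ‖(1 : E →L[ℂ] E) - (c : ℂ) • (ContinuousLinearMap.adjoint T * T)‖ ≤ r := by
  set c := 1 / (‖T‖ ^ 2 + 2) with hc
  set q := c / (‖S‖ + 1) ^ 2 with hq
  have hc0 : 0 < c := by positivity
  have hc1 : c * ‖T‖ ^ 2 ≤ 1 := by
    rw [hc, one_div_mul_eq_div, div_le_one (by positivity)]; linarith
  have hc2 : c ≤ 1 / 2 := one_div_le_one_div_of_le (by norm_num) (by linarith [sq_nonneg ‖T‖])
  have hq0 : 0 < q := by positivity
  have hq1 : q ≤ 1 / 2 :=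
    (div_le_self hc0.le (one_le_pow₀ (by linarith [norm_nonneg S]))).trans hc2
  refine ⟨c, √(1 - q), hc0, Real.sqrt_pos.2 (by linarith), ?_, ?_⟩
  · rw [Real.sqrt_lt' one_pos]; linarith
  refine ContinuousLinearMap.opNorm_le_bound _ (Real.sqrt_nonneg _) fun x => ?_
  have hx : ‖x‖ ≤ (‖S‖ + 1) * ‖T x‖ := by
    calc ‖x‖ = ‖S (T x)‖ := by
          rw [← mul_apply_eq_comp, hST, one_apply_eq_self]
      _ ≤ ‖S‖ * ‖T x‖ := S.le_opNorm _
      _ ≤ _ := by gcongr; linarith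
  have hqx : q * ‖x‖ ^ 2 ≤ c * ‖T x‖ ^ 2 := by
    calc q * ‖x‖ ^ 2 ≤ q * ((‖S‖ + 1) * ‖T x‖) ^ 2 := by gcongr
      _ = _ := by rw [hq]; field_simp
  set y := ContinuousLinearMap.adjoint T (T x) with hy
  have hy1 : ‖y‖ ≤ ‖T‖ * ‖T x‖ := by
    have := (ContinuousLinearMap.adjoint T).le_opNorm (T x)
    rwa [LinearIsometryEquiv.norm_map] at this
  have hin : RCLike.re (inner ℂ x ((c : ℂ) • y)) = c * ‖T x‖ ^ 2 := by
    rw [inner_smul_right, hy, ContinuousLinearMap.adjoint_inner_right,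
      inner_self_eq_norm_sq_to_K]
    simp [← Complex.ofReal_pow, ← Complex.ofReal_mul]
  have hmain : ‖x - (c : ℂ) • y‖ ^ 2 ≤ (1 - q) * ‖x‖ ^ 2 := by
    have hcy : ‖(c : ℂ) • y‖ ^ 2 ≤ c * ‖T x‖ ^ 2 := by
      calc ‖(c : ℂ) • y‖ ^ 2 = c ^ 2 * ‖y‖ ^ 2 := by
            rw [norm_smul, mul_pow, Complex.norm_real, Real.norm_of_nonneg hc0.le]
        _ ≤ c ^ 2 * (‖T‖ * ‖T x‖) ^ 2 := by gcongr
        _ = c * ‖T‖ ^ 2 * (c * ‖T x‖ ^ 2) := by ring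
        _ ≤ 1 * (c * ‖T x‖ ^ 2) := by gcongr
        _ = _ := one_mul _
    rw [@norm_sub_sq ℂ, hin]
    linarith
  have e : ((1 : E →L[ℂ] E) - (c : ℂ) • (ContinuousLinearMap.adjoint T * T)) x
      = x - (c : ℂ) • y := rfl
  rw [e, ← Real.sqrt_sq (norm_nonneg x), ← Real.sqrt_mul (by linarith)]
  exact Real.le_sqrt_of_sq_le hmain

theorem OffDiagBound.exists_inverse {X : Type*} [PseudoMetricSpace X] {H : Type*}
    [NormedAddCommGroup H] [InnerProductSpace ℂ H] [CompleteSpace H] {M α s a : ℝ}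
    (hs : 0 ≤ s) (hα0 : 0 < α) (hα1 : α < 1) (hM0 : 0 ≤ M)
    (hM : ∀ (k : X) (F : Finset X), ∑ m ∈ F, (1 + dist k m) ^ (-(α * s)) ≤ M)
    {S T : lp (fun _ : X => H) 2 →L[ℂ] lp (fun _ : X => H) 2} (ha : 0 ≤ a)
    (hT : OffDiagBound s a T) (hST : S * T = 1) (hTS : T * S = 1) :
    ∃ b, OffDiagBound s b S := by
  have hts : α * s ≤ s := mul_le_of_le_one_left hs hα1.le
  obtain ⟨c, r, hc, hr0, hr1, hr⟩ := exists_norm_one_sub_smul_adjoint_mul_self_le S T hST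
  have hTT := mul_of_exponent_le hs hts hM ha ha hT.adjoint hT
  have hR := (one s).add (hTT.smul (-(c : ℂ)))
  rw [neg_smul, ← sub_eq_add_neg] at hR
  have hc' : (c : ℂ) ≠ 0 := by exact_mod_cast hc.ne'
  have hadj : ContinuousLinearMap.adjoint T * ContinuousLinearMap.adjoint S = 1 := by
    have := congrArg ContinuousLinearMap.adjoint hST
    rw [ContinuousLinearMap.mul_def, ContinuousLinearMap.adjoint_comp] at this
    rw [ContinuousLinearMap.mul_def, this]
    exact ContinuousLinearMap.adjoint_id
  have hadj' : ContinuousLinearMap.adjoint S * ContinuousLinearMap.adjoint T = 1 := by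
    have := congrArg ContinuousLinearMap.adjoint hTS
    rw [ContinuousLinearMap.mul_def, ContinuousLinearMap.adjoint_comp] at this
    rw [ContinuousLinearMap.mul_def, this]
    exact ContinuousLinearMap.adjoint_id
  obtain ⟨b, hb, hQ⟩ := exists_inverse_one_sub hs hα0 hα1 hM0 hM hr0 hr1 hr (by positivity) hR
    (Q := (c : ℂ)⁻¹ • (S * ContinuousLinearMap.adjoint S)) (by
      rw [sub_sub_cancel, smul_mul_smul_comm, mul_inv_cancel₀ hc', one_smul, mul_assoc,
        ← mul_assoc T, hTS, one_mul, hadj])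
  have hfin := (mul_of_exponent_le hs hts hM hb ha hQ hT.adjoint).smul (c : ℂ)
  rw [smul_mul_assoc, smul_smul, mul_inv_cancel₀ hc', one_smul, mul_assoc S, hadj', mul_one] at hfin
  exact ⟨_, hfin⟩

theorem RelSep.card_le {d : ℕ} {X : Set (Euc d)} {N : ℕ}
    (hN : ∀ x : Euc d, (X ∩ {y | ∀ j, x j ≤ y j ∧ y j ≤ x j + 1}).Finite ∧
      (X ∩ {y | ∀ j, x j ≤ y j ∧ y j ≤ x j + 1}).ncard ≤ N)
    (x : Euc d) (F : Finset X) (hF : ∀ m ∈ F, ∀ j, x j ≤ (m : Euc d) j ∧ (m : Euc d) j ≤ x j + 1) :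
    F.card ≤ N := by
  classical
  refine le_trans ?_ (hN x).2
  rw [← Finset.card_map (Function.Embedding.subtype _), ← Set.ncard_coe_finset]
  refine Set.ncard_le_ncard ?_ (hN x).1
  intro y hy
  obtain ⟨m, hm, rfl⟩ := Finset.mem_map.1 hy
  exact ⟨m.2, hF m hm⟩

theorem RelSep.exists_sum_le {d : ℕ} {X : Set (Euc d)} (hX : RelSep X) {t : ℝ} (ht : (d : ℝ) < t) :
    ∃ M : ℝ, 0 ≤ M ∧ ∀ (k : X) (F : Finset X), ∑ m ∈ F, (1 + dist k m) ^ (-t) ≤ M := by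
  classical
  obtain ⟨N, hN⟩ := hX
  have ht0 : 0 < t := (Nat.cast_nonneg d).trans_lt ht
  set L := Submodule.span ℤ (Set.range (Pi.basisFun ℝ (Fin d)))
  have hrank : Module.finrank ℤ L = d := by
    rw [ZLattice.rank ℝ L, Module.finrank_fin_fun]
  have hs1 : Summable fun z : L => ‖z‖ ^ (-t) :=
    ZLattice.summable_norm_rpow L (-t) (by rw [hrank]; linarith)
  have hs2 : Summable fun z : L => if z = 0 then (1 : ℝ) else 0 :=
    summable_of_ne_finset_zero (s := {0}) fun z hz => if_neg (by simpa using hz)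
  have hs := hs1.add hs2
  set g : L → ℝ := fun z => ‖z‖ ^ (-t) + if z = 0 then (1 : ℝ) else 0
  have hg0 : ∀ z, 0 ≤ g z := fun z => by
    have : (0 : ℝ) ≤ if z = 0 then 1 else 0 := by split_ifs <;> norm_num
    positivity
  refine ⟨N * ∑' z, g z, mul_nonneg (Nat.cast_nonneg _) (tsum_nonneg hg0), fun k F => ?_⟩
  have hmem : ∀ m : X, (fun i => ((⌊(m : Euc d) i⌋ - ⌊(k : Euc d) i⌋ : ℤ) : ℝ)) ∈ L := fun m => by
    rw [Module.Basis.mem_span_iff_repr_mem]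
    intro i
    exact ⟨⌊(m : Euc d) i⌋ - ⌊(k : Euc d) i⌋, by simp⟩
  set φ : X → L := fun m => ⟨_, hmem m⟩ with hφ
  have hφa : ∀ m i, (φ m : Fin d → ℝ) i = (⌊(m : Euc d) i⌋ : ℝ) - ⌊(k : Euc d) i⌋ := fun m i => by
    simp [hφ]
  have hle : ∀ m : X, (1 + dist k m) ^ (-t) ≤ g (φ m) := fun m => by
    by_cases h0 : φ m = 0
    · have h1 : (1 + dist k m) ^ (-t) ≤ 1 :=
        Real.rpow_le_one_of_one_le_of_nonpos (one_le_one_add_dist k m) (by linarith)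
      have h2 : (0 : ℝ) ≤ ‖φ m‖ ^ (-t) := by positivity
      simp only [g, if_pos h0]
      linarith
    · have h1 : ‖φ m‖ ≤ 1 + dist k m := by
        rw [Submodule.coe_norm, pi_norm_le_iff_of_nonneg (by positivity)]
        intro i
        have h3 : |(m : Euc d) i - (k : Euc d) i| ≤ dist k m := by
          rw [dist_comm, Subtype.dist_eq, dist_eq_norm]
          exact PiLp.norm_apply_le ((m : Euc d) - (k : Euc d)) i
        rw [hφa, Real.norm_eq_abs]
        rw [abs_le] at h3 ⊢
        constructor <;>
        linarith [Int.floor_le ((m : Euc d) i), Int.lt_floor_add_one ((m : Euc d) i),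
          Int.floor_le ((k : Euc d) i), Int.lt_floor_add_one ((k : Euc d) i)]
      have h2 := Real.rpow_le_rpow_of_nonpos (norm_pos_iff.2 h0) h1 (by linarith : -t ≤ 0)
      simpa [g, h0] using h2
  calc ∑ m ∈ F, (1 + dist k m) ^ (-t) ≤ ∑ m ∈ F, g (φ m) := Finset.sum_le_sum fun m _ => hle m
    _ = ∑ z ∈ F.image φ, ∑ m ∈ F with φ m = z, g (φ m) :=
        (Finset.sum_fiberwise_of_maps_to (fun m hm => Finset.mem_image_of_mem φ hm) _).symm
    _ ≤ ∑ z ∈ F.image φ, N * g z := by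
        refine Finset.sum_le_sum fun z _ => ?_
        rw [Finset.sum_congr rfl fun m hm => by rw [(Finset.mem_filter.1 hm).2],
          Finset.sum_const, nsmul_eq_mul]
        refine mul_le_mul_of_nonneg_right (Nat.cast_le.2 ?_) (hg0 z)
        refine RelSep.card_le hN
          (WithLp.toLp 2 fun i => (z : Fin d → ℝ) i + ⌊(k : Euc d) i⌋) _ fun m hm j => ?_
        have hz := hφa m j
        rw [(Finset.mem_filter.1 hm).2] at hz
        simp only [hz]
        constructor <;>
        linarith [Int.floor_le ((m : Euc d) j), Int.lt_floor_add_one ((m : Euc d) j)]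
    _ ≤ N * ∑' z, g z := by
        rw [← Finset.mul_sum]
        gcongr
        exact hs.sum_le_tsum _ fun z _ => hg0 z

theorem statement6 {d : ℕ} (X : Set (Euc d)) (hX : RelSep X)
    (H : Type*) [NormedAddCommGroup H] [InnerProductSpace ℂ H] [CompleteSpace H]
    [TopologicalSpace.SeparableSpace H]
    (s : ℝ) (hs : (d : ℝ) < s)
    (A : ↥X → ↥X → (H →L[ℂ] H))
    (hA : BddAbove (Set.range fun q : ↥X × ↥X =>
      ‖A q.1 q.2‖ * (1 + ‖(q.1 : Euc d) - (q.2 : Euc d)‖) ^ s))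
    (T : lp (fun _ : ↥X => H) 2 →L[ℂ] lp (fun _ : ↥X => H) 2)
    (hT : ∀ (f : lp (fun _ : ↥X => H) 2) (k : ↥X), T f k = ∑' l : ↥X, A k l (f l))
    (S : lp (fun _ : ↥X => H) 2 →L[ℂ] lp (fun _ : ↥X => H) 2)
    (hST : S.comp T = ContinuousLinearMap.id ℂ _)
    (hTS : T.comp S = ContinuousLinearMap.id ℂ _) :
    ∃ C : ℝ, ∀ (k l : ↥X) (f : H),
      ‖(S (deltaSeq 2 l f)) k‖ * (1 + ‖(k : Euc d) - (l : Euc d)‖) ^ s ≤ C * ‖f‖ := by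
  have hs0 : 0 < s := (Nat.cast_nonneg d).trans_lt hs
  obtain ⟨α, hα, hα1⟩ := exists_between ((div_lt_one hs0).2 hs)
  have hα0 : 0 < α := (by positivity : (0 : ℝ) ≤ d / s).trans_lt hα
  obtain ⟨M, hM0, hM⟩ := hX.exists_sum_le ((div_lt_iff₀ hs0).1 hα)
  obtain ⟨a, ha⟩ := hA
  have hTb : OffDiagBound s (max a 0) T := fun k l f => by
    have e : T (deltaSeq 2 l f) k = A k l f := by
      rw [hT, tsum_eq_single l fun m hm => by rw [deltaSeq_of_ne 2 f hm, map_zero], deltaSeq_self]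
    have h1 : ‖A k l‖ * (1 + dist k l) ^ s ≤ max a 0 := by
      rw [Subtype.dist_eq, dist_eq_norm]
      exact (ha ⟨(k, l), rfl⟩).trans (le_max_left _ _)
    rw [e, Real.rpow_neg (by linarith [one_le_one_add_dist k l]), ← div_eq_mul_inv]
    exact (A k l).le_of_opNorm_le ((le_div_iff₀ (rpow_weight_pos k l s)).2 h1) f
  obtain ⟨b, hb⟩ := OffDiagBound.exists_inverse hs0.le hα0 hα1 hM0 hM (le_max_right a 0) hTb hST hTS
  refine ⟨b, fun k l f => ?_⟩
  rw [← dist_eq_norm, ← Subtype.dist_eq, ← le_div_iff₀ (rpow_weight_pos k l s)]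
  refine (hb k l f).trans_eq ?_
  rw [Real.rpow_neg (by linarith [one_le_one_add_dist k l])]
  ring
end
end
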